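/- arXiv:1711.06941 — 2 statements merged into one kernel-verified Lean document; each statement's English description precedes it below -/
import Mathlib

section
/- There exists a constant C > 0 such that for all integers n ≥ 0 and all integers k with 0 ≤ k ≤ n, |μ_{n,k} − 2^k · F(2^{−k} n)| ≤ C. (That is, the expected external profile of a random symmetric digital search tree satisfies E(B_{n,k}) = 2^k F(2^{−k} n) + O(1) uniformly for 0 ≤ k ≤ n.) -/
open Filter Real

/-- `Q j = ∏_{ℓ=1}^{j} (1 - 2^{-ℓ})`. -/
noncomputable def Q (j : ℕ) : ℝ := ∏ l ∈ Finset.range j, (1 - (2:ℝ)^(-(l:ℤ)-1))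

/-- `Q_∞ = ∏_{ℓ≥1} (1 - 2^{-ℓ})`. -/
noncomputable def Qinf : ℝ := ∏' l : ℕ, (1 - (2:ℝ)^(-(l:ℤ)-1))

/-- `F(x) = ∑_{j≥0} (-1)^j 2^{-j(j-1)/2} e^{-2^j x} / (Q_j Q_∞)`. -/
noncomputable def F (x : ℝ) : ℝ :=
  ∑' j : ℕ, (-1:ℝ)^j * ((2:ℝ)^(j.choose 2))⁻¹ * Real.exp (-(2:ℝ)^j * x) / (Q j * Qinf)

/-- Expected external profile `μ_{n,k}` of a random symmetric digital search tree. -/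
noncomputable def mu : ℕ → ℕ → ℝ
  | n, 0 => if n = 0 then 1 else 0
  | n, k + 1 => (2:ℝ)^((2:ℤ) - (n:ℤ)) *
      ∑ j ∈ Finset.range n, ((n-1).choose j : ℝ) * mu j k


lemma zq (l : ℕ) : (2:ℝ)^(-(l:ℤ)-1) = (1/2:ℝ)^(l+1) := by
  rw [show -(l:ℤ)-1 = -((l+1:ℕ):ℤ) by push_cast; ring, zpow_neg, zpow_natCast, one_div, inv_pow]

lemma Q_zero : Q 0 = 1 := by simp [Q]

lemma Q_succ (j : ℕ) : Q (j+1) = Q j * (1 - (1/2:ℝ)^(j+1)) := by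
  simp only [Q]; rw [Finset.prod_range_succ, zq]

lemma hp_pos (j : ℕ) : 0 < (1/2:ℝ)^j := by positivity

lemma hp_le (j : ℕ) : (1/2:ℝ)^j ≤ 1 := pow_le_one₀ (by norm_num) (by norm_num)

lemma Q_lower (j : ℕ) : 1/4 + (1/2:ℝ)^(j+2) ≤ Q (j+1) := by
  induction j with
  | zero => rw [Q_succ, Q_zero]; norm_num
  | succ j ih =>
    rw [Q_succ]
    have h1 := hp_pos j
    have h2 := hp_le j
    have h3 : 0 ≤ 1 - (1/2:ℝ)^(j+1+1) := by linarith [hp_le (j+1+1)]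
    have := mul_le_mul_of_nonneg_right ih h3
    refine le_trans ?_ this
    simp only [pow_succ]
    nlinarith

lemma Q_ge (j : ℕ) : 1/4 ≤ Q j := by
  cases j with
  | zero => rw [Q_zero]; norm_num
  | succ j => linarith [Q_lower j, hp_pos (j+2)]

lemma Q_pos (j : ℕ) : 0 < Q j := by linarith [Q_ge j]

lemma Q_anti : Antitone Q := antitone_nat_of_succ_le fun j => by
  rw [Q_succ]
  nlinarith [Q_pos j, hp_pos (j+1)]

lemma Q_le (j : ℕ) : Q j ≤ 1 := by
  have := Q_anti (Nat.zero_le j); rwa [Q_zero] at this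

lemma Q_sub_mono : Monotone (fun j => Q j - (1/2:ℝ)^j) := monotone_nat_of_le_succ fun j => by
  rw [Q_succ, pow_succ]
  nlinarith [Q_le j, hp_pos j]

lemma Q_tendsto : Tendsto Q atTop (nhds Qinf) := by
  have hs : Summable (fun l : ℕ => ‖-(2:ℝ)^(-(l:ℤ)-1)‖) := by
    have : (fun l : ℕ => ‖-(2:ℝ)^(-(l:ℤ)-1)‖) = fun l : ℕ => (1/2:ℝ)^l * (1/2) := by
      funext l
      rw [norm_neg, zq, pow_succ, Real.norm_of_nonneg (by positivity)]
    rw [this]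
    exact (summable_geometric_of_lt_one (by norm_num) (by norm_num)).mul_right _
  have hm := multipliable_one_add_of_summable hs
  have := hm.hasProd.tendsto_prod_nat
  simp only [← sub_eq_add_neg] at this
  exact this

lemma Qinf_le (j : ℕ) : Qinf ≤ Q j := Q_anti.le_of_tendsto Q_tendsto j

lemma Qinf_ge : 1/4 ≤ Qinf := ge_of_tendsto' Q_tendsto Q_ge

lemma Q_sub_le (m : ℕ) : Q m - (1/2:ℝ)^m ≤ Qinf := by
  refine ge_of_tendsto Q_tendsto ?_
  filter_upwards [eventually_ge_atTop m] with j hj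
  have := Q_sub_mono hj
  simp only at this
  linarith [hp_pos j]

lemma qbin (i : ℕ) : ∀ m : ℕ,
    (∑ j ∈ Finset.range (i+1), (-1:ℝ)^j * ((2:ℝ)^(j.choose 2))⁻¹ / (Q j * Q (i+1+m-j)))
      * (1 - (1/2:ℝ)^(i+1+m)) = (-1:ℝ)^i * ((2:ℝ)^((i+1).choose 2))⁻¹ / (Q i * Q m) := by
  induction i with
  | zero =>
    intro m
    have e : 0+1+m = m+1 := by omega
    have h1 : (1 - (1/2:ℝ)^(m+1)) ≠ 0 := by
      have := hp_le m; rw [pow_succ]; intro h; linarith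
    have := (Q_pos m).ne'
    have hs : ∀ f : ℕ → ℝ, ∑ j ∈ Finset.range (0+1), f j = f 0 := fun f => by simp
    rw [hs, e, Nat.sub_zero, Q_zero, Q_succ]
    simp only [pow_zero, zero_add, Nat.choose_zero_succ, Nat.choose_one_right,
      show Nat.choose 1 2 = 0 from rfl, show Nat.choose 0 2 = 0 from rfl]
    field_simp
  | succ i ih =>
    intro m
    have h := ih (m+1)
    rw [show i+1+(m+1) = i+1+1+m by ring] at h
    rw [Finset.sum_range_succ, add_mul, h, show i+1+1+m-(i+1) = m+1 by omega]
    have c : (i+1+1).choose 2 = (i+1).choose 2 + (i+1) := by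
      rw [Nat.choose_succ_succ' (i+1) 1, Nat.choose_one_right, add_comm]
    have h1 : (1 - (1/2:ℝ)^(m+1)) ≠ 0 := by
      have := hp_le m; rw [pow_succ]; intro h; linarith
    have h2 : (1 - (1/2:ℝ)^(i+1)) ≠ 0 := by
      have := hp_le i; rw [pow_succ]; intro h; linarith
    have h3 := (Q_pos m).ne'
    have h4 := (Q_pos i).ne'
    rw [c, Q_succ m, Q_succ i, pow_add 2, mul_inv, ← inv_pow 2 (i+1),
      show (2:ℝ)⁻¹ = 1/2 by norm_num,
      show (1/2:ℝ)^(i+1+1+m) = (1/2)^(i+1) * (1/2)^(m+1) by rw [← pow_add]; congr 1; omega,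
      pow_succ (-1:ℝ) i]
    generalize (1/2:ℝ)^(i+1) = a at *
    generalize (1/2:ℝ)^(m+1) = b at *
    generalize ((2:ℝ)^((i+1).choose 2))⁻¹ = c at *
    field_simp
    ring

lemma qbin_zero (k : ℕ) :
    ∑ j ∈ Finset.range (k+1+1), (-1:ℝ)^j * ((2:ℝ)^(j.choose 2))⁻¹ / (Q j * Q (k+1-j)) = 0 := by
  have h1 : (1 - (1/2:ℝ)^(k+1)) ≠ 0 := by
    have := hp_le k; rw [pow_succ]; intro h; linarith
  have h := qbin k 0
  rw [add_zero] at h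
  have h4 := (Q_pos k).ne'
  apply mul_right_cancel₀ h1
  rw [Finset.sum_range_succ, add_mul, h, Nat.sub_self, Q_zero, Q_succ, pow_succ (-1:ℝ)]
  field_simp
  ring

lemma mu_eq (k : ℕ) : ∀ n : ℕ, mu n k = 2^k * ∑ j ∈ Finset.range (k+1),
    (-1:ℝ)^j * ((2:ℝ)^(j.choose 2))⁻¹ / (Q j * Q (k-j)) * (1 - (1/2:ℝ)^(k-j))^n := by
  induction k with
  | zero =>
    intro n
    rcases n with _ | n <;> simp [mu, Q_zero]
  | succ k ih =>
    intro n
    rcases n with _ | p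
    · simp only [mu, pow_zero, mul_one, qbin_zero]; simp
    · rw [mu, Finset.sum_range_succ _ (k+1)]
      simp only [ih, Nat.add_sub_cancel]
      simp only [Finset.mul_sum]
      rw [Finset.sum_comm]
      simp only [Nat.sub_self, pow_zero, sub_self, ne_eq, Nat.add_eq_zero_iff, one_ne_zero,
        and_false, not_false_eq_true, zero_pow, mul_zero, add_zero]
      rw [Finset.mul_sum]
      apply Finset.sum_congr rfl
      intro j hj
      have hj' : j ≤ k := by simpa [Nat.lt_succ_iff] using hj
      obtain ⟨m, rfl⟩ := Nat.exists_eq_add_of_le hj'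
      rw [show j+m-j = m by omega, show j+m+1-j = m+1 by omega, Q_succ m]
      have h1 : (1 - (1/2:ℝ)^(m+1)) ≠ 0 := by
        have := hp_le m; rw [pow_succ]; intro h; linarith
      have h3 := (Q_pos m).ne'
      have h4 := (Q_pos j).ne'
      have hb : ∑ i ∈ Finset.range (p+1), (p.choose i : ℝ) * (1 - (1/2:ℝ)^m)^i
          = 2^p * (1 - (1/2:ℝ)^(m+1))^p := by
        rw [← mul_pow, show 2 * (1 - (1/2:ℝ)^(m+1)) = (1 - (1/2:ℝ)^m) + 1 by
          rw [pow_succ]; ring, add_pow]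
        apply Finset.sum_congr rfl
        intro i _
        simp [mul_comm]
      have hz : (2:ℝ)^((2:ℤ) - ((p+1:ℕ):ℤ)) = 2 / 2^p := by
        rw [show (2:ℤ) - ((p+1:ℕ):ℤ) = 1 - (p:ℤ) by push_cast; ring, zpow_sub₀ (by norm_num)]
        simp
      rw [hz]
      calc _ = 2 / 2^p * (2^(j+m) * ((-1:ℝ)^j * ((2:ℝ)^(j.choose 2))⁻¹ / (Q j * Q m))) *
            ∑ i ∈ Finset.range (p+1), (p.choose i : ℝ) * (1 - (1/2:ℝ)^m)^i := by
            rw [Finset.mul_sum]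
            apply Finset.sum_congr rfl
            intro i _
            ring
        _ = _ := by
            rw [hb, pow_succ (1 - (1/2:ℝ)^(m+1)) p, pow_succ (2:ℝ) (j+m)]
            generalize (1 - (1/2:ℝ)^(m+1)) = a at *
            generalize ((2:ℝ)^(j.choose 2))⁻¹ = c at *
            field_simp

lemma pow_diff (a b : ℝ) (hb : 0 ≤ b) (hab : b ≤ a) (n : ℕ) :
    a^(n+1) - b^(n+1) ≤ (n+1) * (a-b) * a^n := by
  induction n with
  | zero => simp
  | succ n ih =>
    have ha : 0 ≤ a := hb.trans hab
    have h1 := mul_le_mul_of_nonneg_left ih ha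
    have h2 := mul_le_mul_of_nonneg_left (pow_le_pow_left₀ hb hab (n+1)) (sub_nonneg.2 hab)
    push_cast
    calc a^(n+1+1) - b^(n+1+1) = a * (a^(n+1) - b^(n+1)) + (a-b) * b^(n+1) := by ring
      _ ≤ a * ((n+1) * (a-b) * a^n) + (a-b) * a^(n+1) := add_le_add h1 h2
      _ = _ := by ring

lemma exp_diff (x : ℝ) (h0 : 0 ≤ x) (h1 : x ≤ 1) (n : ℕ) :
    |(1-x)^n - Real.exp (-x * n)| ≤ x := by
  have he : Real.exp (-x * n) = (Real.exp (-x))^n := by rw [mul_comm, Real.exp_nat_mul]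
  have hab : 1 - x ≤ Real.exp (-x) := by linarith [Real.add_one_le_exp (-x)]
  have hb : 0 ≤ 1 - x := by linarith
  rw [abs_sub_comm, he, abs_of_nonneg (sub_nonneg.2 (pow_le_pow_left₀ hb hab n))]
  rcases n with _ | n
  · simpa
  refine (pow_diff _ _ hb hab n).trans ?_
  have h2 : Real.exp (-x) - (1-x) ≤ x^2 := by
    have := (abs_le.1 (Real.abs_exp_sub_one_sub_id_le (x := -x) (by rw [abs_neg, abs_of_nonneg h0]; exact h1))).2
    nlinarith
  have h3 : ((n+1:ℝ)*x) * (Real.exp (-x))^n ≤ 1 := by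
    rw [← Real.exp_nat_mul]
    have : (n+1:ℝ)*x ≤ Real.exp (n*x) := by
      have := Real.add_one_le_exp (n*x)
      nlinarith
    calc _ ≤ Real.exp (n*x) * Real.exp (n * -x) := by gcongr
      _ = 1 := by rw [← Real.exp_add]; simp
  calc (n+1:ℝ) * (Real.exp (-x) - (1-x)) * (Real.exp (-x))^n
      ≤ (n+1:ℝ) * x^2 * (Real.exp (-x))^n := by gcongr
    _ = x * (((n+1:ℝ)*x) * (Real.exp (-x))^n) := by ring
    _ ≤ x * 1 := by gcongr
    _ = x := mul_one x

lemma term_bound (m n : ℕ) :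
    |(1-(1/2:ℝ)^m)^n / Q m - Real.exp (-(1/2:ℝ)^m * n) / Qinf| ≤ 20 * (1/2:ℝ)^m := by
  have hx0 := hp_pos m
  have hx1 := hp_le m
  have hd := exp_diff _ hx0.le hx1 n
  have hq := Q_ge m
  have hQ := Qinf_ge
  have hq0 : 0 < Q m := Q_pos m
  have hQ0 : 0 < Qinf := by linarith
  have he : Real.exp (-(1/2:ℝ)^m * n) ≤ 1 := by
    rw [Real.exp_le_one_iff]
    have : 0 ≤ (1/2:ℝ)^m * n := by positivity
    linarith
  have he0 := Real.exp_pos (-(1/2:ℝ)^m * n)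
  have hs := Q_sub_le m
  have hl := Qinf_le m
  generalize (1/2:ℝ)^m = x at *
  generalize Real.exp (-x * n) = e at *
  have i1 : (Q m)⁻¹ ≤ 4 := by rw [inv_le_comm₀ hq0 (by norm_num)]; linarith
  have i2 : (Qinf)⁻¹ ≤ 4 := by rw [inv_le_comm₀ hQ0 (by norm_num)]; linarith
  have e1 : (1-x)^n / Q m - e / Qinf
      = ((1-x)^n - e) * (Q m)⁻¹ - e * ((Q m - Qinf) * ((Q m)⁻¹ * Qinf⁻¹)) := by
    field_simp; ring
  rw [e1]
  have a1 : |((1-x)^n - e) * (Q m)⁻¹| ≤ x * 4 := by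
    rw [abs_mul, abs_of_pos (inv_pos.2 hq0)]
    gcongr
  have a2 : |e * ((Q m - Qinf) * ((Q m)⁻¹ * Qinf⁻¹))| ≤ 1 * (x * (4 * 4)) := by
    have hnn : 0 ≤ Q m - Qinf := by linarith
    rw [abs_of_nonneg (by positivity)]
    have : Q m - Qinf ≤ x := by linarith
    gcongr
  have := abs_sub (((1-x)^n - e) * (Q m)⁻¹) (e * ((Q m - Qinf) * ((Q m)⁻¹ * Qinf⁻¹)))
  linarith

lemma choose_bd (j : ℕ) : 2 * j ≤ j.choose 2 + 3 := by
  induction j with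
  | zero => simp
  | succ j ih =>
    rw [Nat.choose_succ_succ' j 1, Nat.choose_one_right]
    rcases j with _ | _ | j
    · simp
    · simp
    · simp only [Nat.reduceAdd] at *
      omega

lemma wt_bd (j : ℕ) : (2:ℝ)^j * ((2:ℝ)^(j.choose 2))⁻¹ ≤ 8 * (1/2:ℝ)^j := by
  have h : (2:ℝ)^(2*j) ≤ 2^(j.choose 2 + 3) := pow_le_pow_right₀ (by norm_num) (choose_bd j)
  rw [pow_add, two_mul, pow_add] at h
  rw [one_div, inv_pow, ← div_eq_mul_inv, ← div_eq_mul_inv, div_le_div_iff₀ (by positivity) (by positivity)]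
  linarith

lemma coef_bd (j : ℕ) (y : ℝ) (B : ℝ) (hy : |y| ≤ B * 2^j) :
    |(-1:ℝ)^j * ((2:ℝ)^(j.choose 2))⁻¹ / Q j * y| ≤ 32 * B * (1/2:ℝ)^j := by
  have hq0 := Q_pos j
  have i1 : (Q j)⁻¹ ≤ 4 := by rw [inv_le_comm₀ hq0 (by norm_num)]; linarith [Q_ge j]
  have hB : 0 ≤ B := by
    have h2 : (0:ℝ) < 2^j := by positivity
    have := (abs_nonneg y).trans hy
    exact nonneg_of_mul_nonneg_left this h2
  rw [abs_mul, abs_div, abs_mul, abs_pow, abs_neg, abs_one, one_pow, one_mul, abs_of_pos hq0,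
    abs_of_pos (show 0 < ((2:ℝ)^(j.choose 2))⁻¹ by positivity), div_eq_mul_inv]
  calc _ ≤ ((2:ℝ)^(j.choose 2))⁻¹ * 4 * (B * 2^j) := by gcongr
    _ = 4 * B * ((2:ℝ)^j * ((2:ℝ)^(j.choose 2))⁻¹) := by ring
    _ ≤ 4 * B * (8 * (1/2:ℝ)^j) := mul_le_mul_of_nonneg_left (wt_bd j) (by positivity)
    _ = _ := by ring

lemma F_hasSum (x : ℝ) (hx : 0 ≤ x) : HasSum (fun j : ℕ =>
    (-1:ℝ)^j * ((2:ℝ)^(j.choose 2))⁻¹ / Q j * (Real.exp (-(2:ℝ)^j * x) / Qinf)) (F x) := by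
  have hQ := Qinf_ge
  have hQ0 : 0 < Qinf := by linarith
  have hs : Summable (fun j : ℕ =>
    (-1:ℝ)^j * ((2:ℝ)^(j.choose 2))⁻¹ / Q j * (Real.exp (-(2:ℝ)^j * x) / Qinf)) := by
    refine Summable.of_norm_bounded (g := fun j => 32 * 4 * (1/2:ℝ)^j)
      ((summable_geometric_of_lt_one (by norm_num) (by norm_num)).mul_left _) fun j => ?_
    refine coef_bd j _ 4 ?_
    rw [abs_of_pos (by positivity)]
    have he : Real.exp (-(2:ℝ)^j * x) ≤ 1 := by
      rw [Real.exp_le_one_iff]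
      have : 0 ≤ (2:ℝ)^j * x := by positivity
      linarith
    have i2 : (Qinf)⁻¹ ≤ 4 := by rw [inv_le_comm₀ hQ0 (by norm_num)]; linarith
    have : (1:ℝ) ≤ 2^j := one_le_pow₀ (by norm_num)
    calc Real.exp (-(2:ℝ)^j * x) / Qinf ≤ 1 * 4 := by rw [div_eq_mul_inv]; gcongr
      _ ≤ 4 * 2^j := by linarith
  have e := hs.hasSum
  convert e using 1
  unfold F
  apply tsum_congr
  intro j
  have := (Q_pos j).ne'
  field_simp

/-- `E(B_{n,k}) = 2^k F(2^{-k} n) + O(1)` uniformly for `0 ≤ k ≤ n`. -/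
theorem mean_external_profile : ∃ C > (0:ℝ), ∀ n k : ℕ, k ≤ n →
    |mu n k - (2:ℝ)^k * F ((2:ℝ)^(-(k:ℤ)) * n)| ≤ C := by
  refine ⟨32 * 20 * 2, by norm_num, fun n k _ => ?_⟩
  have hQ := Qinf_ge
  have hQ0 : 0 < Qinf := by linarith
  have i2 : (Qinf)⁻¹ ≤ 4 := by rw [inv_le_comm₀ hQ0 (by norm_num)]; linarith
  have hF := (F_hasSum ((2:ℝ)^(-(k:ℤ)) * n) (by positivity)).mul_left ((2:ℝ)^k)
  have hM : HasSum (fun j : ℕ => (2:ℝ)^k * ((-1:ℝ)^j * ((2:ℝ)^(j.choose 2))⁻¹ / Q j *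
      (if j ≤ k then (1 - (1/2:ℝ)^(k-j))^n / Q (k-j) else 0))) (mu n k) := by
    rw [mu_eq, Finset.mul_sum]
    have h := hasSum_sum_of_ne_finset_zero (L := SummationFilter.unconditional ℕ) (s := Finset.range (k+1)) (f := fun j : ℕ =>
      (2:ℝ)^k * ((-1:ℝ)^j * ((2:ℝ)^(j.choose 2))⁻¹ / Q j *
      (if j ≤ k then (1 - (1/2:ℝ)^(k-j))^n / Q (k-j) else 0))) (by
        intro j hj
        have : ¬ j ≤ k := by simpa [Nat.lt_succ_iff] using hj
        simp [this])
    convert h using 1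
    apply Finset.sum_congr rfl
    intro j hj
    have : j ≤ k := by simpa [Nat.lt_succ_iff] using hj
    have := (Q_pos j).ne'
    have := (Q_pos (k-j)).ne'
    simp only [*, if_true]
    field_simp
  have hD := hM.sub hF
  rw [← hD.tsum_eq, ← Real.norm_eq_abs]
  refine tsum_of_norm_bounded (hasSum_geometric_two.mul_left (32*20)) fun j => ?_
  rw [← mul_sub, ← mul_sub, mul_left_comm]
  refine coef_bd j _ 20 ?_
  rw [abs_mul, abs_of_pos (by positivity : (0:ℝ) < 2^k)]
  split_ifs with hjk
  · obtain ⟨m, rfl⟩ := Nat.exists_eq_add_of_le hjk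
    rw [show j+m-j = m by omega, show -(2:ℝ)^j * ((2:ℝ)^(-((j+m:ℕ):ℤ)) * n) = -(1/2:ℝ)^m * n by
      rw [zpow_neg, zpow_natCast, pow_add, one_div, inv_pow]; field_simp]
    calc _ ≤ (2:ℝ)^(j+m) * (20 * (1/2:ℝ)^m) := by gcongr; exact term_bound m n
      _ = _ := by rw [pow_add, one_div, inv_pow]; field_simp
  · have he : Real.exp (-(2:ℝ)^j * ((2:ℝ)^(-(k:ℤ)) * n)) ≤ 1 := by
      rw [Real.exp_le_one_iff]
      have : 0 ≤ (2:ℝ)^j * ((2:ℝ)^(-(k:ℤ)) * n) := by positivity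
      linarith
    rw [zero_sub, abs_neg, abs_of_pos (by positivity), div_eq_mul_inv]
    have : (2:ℝ)^k ≤ 2^j := pow_le_pow_right₀ (by norm_num) (by omega)
    have h2 : (0:ℝ) < 2^j := by positivity
    calc _ ≤ (2:ℝ)^j * (1 * 4) := by gcongr
      _ ≤ _ := by linarith
end

section
/- For every function k : ℕ → ℕ satisfying k(n) ≤ n for all n, the sequence μ_{n,k(n)} tends to infinity as n → ∞ if and only if the sequence ν_{n,k(n)} − μ_{n,k(n)}² tends to infinity as n → ∞. (That is, for large n and 0 ≤ k ≤ n, E(B_{n,k}) → ∞ if and only if Var(B_{n,k}) → ∞.) -/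
open Filter Real

/-- Second moment `ν_{n,k}` of the external profile. -/
noncomputable def nu : ℕ → ℕ → ℝ
  | n, 0 => if n = 0 then 1 else 0
  | n, k + 1 => (2:ℝ)^((2:ℤ) - (n:ℤ)) *
      (∑ j ∈ Finset.range n, ((n-1).choose j : ℝ) * nu j k)
    + (2:ℝ)^((2:ℤ) - (n:ℤ)) *
      (∑ j ∈ Finset.range n, ((n-1).choose j : ℝ) * mu j k * mu (n-1-j) k)

/-- Expectation of `F(J, n-J)` with `J` binomial `(n,1/2)`. -/
noncomputable def Eb : ℕ → (ℕ → ℕ → ℝ) → ℝ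
  | 0, F => F 0 0
  | n + 1, F => (Eb n (fun i j => F (i+1) j) + Eb n (fun i j => F i (j+1))) / 2

lemma Eb_eq (n : ℕ) : ∀ F : ℕ → ℕ → ℝ,
    Eb n F = (1/2:ℝ)^n * ∑ ij ∈ Finset.HasAntidiagonal.antidiagonal n, (n.choose ij.1 : ℝ) * F ij.1 ij.2 := by
  induction n with
  | zero => intro F; simp [Eb]
  | succ n ih =>
    intro F
    have hs : ∑ ij ∈ Finset.HasAntidiagonal.antidiagonal n, (n.choose ij.2 : ℝ) * F (ij.1+1) ij.2
        = ∑ ij ∈ Finset.HasAntidiagonal.antidiagonal n, (n.choose ij.1 : ℝ) * F (ij.1+1) ij.2 := by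
      apply Finset.sum_congr rfl
      intro ij hij
      rw [Finset.HasAntidiagonal.mem_antidiagonal] at hij
      rw [Nat.choose_symm_of_eq_add (n := n) (a := ij.2) (b := ij.1) (by omega)]
    rw [Finset.sum_antidiagonal_choose_succ_mul, hs]
    simp only [Eb, ih]
    ring

lemma Eb_add (n : ℕ) : ∀ F G : ℕ → ℕ → ℝ, Eb n (fun i j => F i j + G i j) = Eb n F + Eb n G := by
  induction n with
  | zero => intro F G; simp [Eb]
  | succ n ih => intro F G; simp only [Eb, ih]; ring

lemma Eb_smul (n : ℕ) (c : ℝ) : ∀ F : ℕ → ℕ → ℝ, Eb n (fun i j => c * F i j) = c * Eb n F := by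
  induction n with
  | zero => intro F; simp [Eb]
  | succ n ih => intro F; simp only [Eb, ih]; ring

lemma Eb_sub (n : ℕ) : ∀ F G : ℕ → ℕ → ℝ, Eb n (fun i j => F i j - G i j) = Eb n F - Eb n G := by
  induction n with
  | zero => intro F G; simp [Eb]
  | succ n ih => intro F G; simp only [Eb, ih]; ring

lemma Eb_mono (n : ℕ) : ∀ F G : ℕ → ℕ → ℝ, (∀ i j, F i j ≤ G i j) → Eb n F ≤ Eb n G := by
  induction n with
  | zero => intro F G h; exact h 0 0
  | succ n ih =>
    intro F G h
    simp only [Eb]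
    have h1 := ih (fun i j => F (i+1) j) (fun i j => G (i+1) j) (fun i j => h _ _)
    have h2 := ih (fun i j => F i (j+1)) (fun i j => G i (j+1)) (fun i j => h _ _)
    linarith

lemma Eb_nonneg (n : ℕ) (F : ℕ → ℕ → ℝ) (h : ∀ i j, 0 ≤ F i j) : 0 ≤ Eb n F := by
  have h1 := Eb_mono n (fun i j => 0 * F i j) F (fun i j => by simpa using h i j)
  rw [Eb_smul] at h1
  linarith

lemma Eb_swap (n : ℕ) : ∀ F : ℕ → ℕ → ℝ, Eb n (fun i j => F j i) = Eb n F := by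
  induction n with
  | zero => intro F; simp [Eb]
  | succ n ih =>
    intro F; simp only [Eb]
    rw [ih (fun i j => F i (j+1)), ih (fun i j => F (i+1) j)]; ring

/-- Variance of `F(J,n-J)`. -/
noncomputable def Vb (n : ℕ) (F : ℕ → ℕ → ℝ) : ℝ := Eb n (fun i j => F i j ^ 2) - (Eb n F)^2

lemma Vb_succ (n : ℕ) (F : ℕ → ℕ → ℝ) : Vb (n+1) F =
    (Vb n (fun i j => F (i+1) j) + Vb n (fun i j => F i (j+1))) / 2
     + (Eb n (fun i j => F (i+1) j - F i (j+1)))^2 / 4 := by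
  rw [Eb_sub]
  simp only [Vb, Eb]
  ring

lemma Vb_nonneg (n : ℕ) : ∀ F : ℕ → ℕ → ℝ, 0 ≤ Vb n F := by
  induction n with
  | zero => intro F; simp [Vb, Eb]
  | succ n ih =>
    intro F
    rw [Vb_succ]
    have h1 := ih (fun i j => F (i+1) j)
    have h2 := ih (fun i j => F i (j+1))
    positivity

lemma Vb_poincare (n : ℕ) : ∀ F : ℕ → ℕ → ℝ,
    Vb (n+1) F ≤ (n+1)/4 * Eb n (fun i j => (F (i+1) j - F i (j+1))^2) := by
  induction n with
  | zero => intro F; simp [Vb, Eb]; nlinarith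
  | succ n ih =>
    intro F
    rw [Vb_succ]
    have h1 := ih (fun i j => F (i+1) j)
    have h2 := ih (fun i j => F i (j+1))
    have h3 := Vb_nonneg (n+1) (fun i j => F (i+1) j - F i (j+1))
    have h4 : Eb (n+1) (fun i j => (F (i+1) j - F i (j+1))^2) =
      (Eb n (fun i j => (F (i+1+1) j - F (i+1) (j+1))^2) + Eb n (fun i j => (F (i+1) (j+1) - F i (j+1+1))^2))/2 := rfl
    unfold Vb at h3
    push_cast
    simp only at h3
    rw [h4] at h3 ⊢
    linarith

lemma Eb_sizebias (n : ℕ) : ∀ f : ℕ → ℝ,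
    Eb (n+1) (fun i _ => (i:ℝ) * f (i-1)) = (n+1)/2 * Eb n (fun i _ => f i) := by
  induction n with
  | zero => intro f; simp [Eb]; ring
  | succ n ih =>
    intro f
    have e1 : Eb (n+1+1) (fun i _ => (i:ℝ) * f (i-1)) =
      (Eb (n+1) (fun i _ => ((i+1:ℕ):ℝ) * f i) + Eb (n+1) (fun i _ => (i:ℝ) * f (i-1)))/2 := rfl
    have e2 : (fun (i _ : ℕ) => ((i+1:ℕ):ℝ) * f i) = (fun (i j : ℕ) => (fun (i _ : ℕ) => (i:ℝ) * (fun t => f (t+1)) (i-1)) i j + (fun (i _ : ℕ) => f i) i j) := by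
      funext i j
      rcases i with _ | i
      · simp
      · simp; ring
    have e3 : Eb (n+1) (fun i _ => f i) = (Eb n (fun i _ => f (i+1)) + Eb n (fun i _ => f i))/2 := rfl
    have i2 : Eb (n+1) (fun i _ => (i:ℝ) * (fun t => f (t+1)) (i-1)) = (n+1)/2 * Eb n (fun i _ => f (i+1)) := ih (fun t => f (t+1))
    rw [e1, e2, Eb_add, ih f, i2]
    push_cast
    rw [e3]
    ring

lemma Eb_sizebias2 (n : ℕ) (f : ℕ → ℝ) :
    Eb (n+2) (fun i _ => (i:ℝ) * (((i-1 : ℕ):ℝ) * f (i-1-1))) = (n+2)*(n+1)/4 * Eb n (fun i _ => f i) := by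
  rw [Eb_sizebias (n+1) (fun i => (i:ℝ) * f (i-1)), Eb_sizebias]
  push_cast
  ring

lemma toll_bound (n : ℕ) (f : ℕ → ℝ) :
    Vb (n+2) (fun i j => f i + f j) ≤
      (n+2)*(n+1)/4 * Eb n (fun i _ => (f (i+2) - 2 * f (i+1) + f i)^2) := by
  have h1 := Vb_poincare (n+1) (fun i j => f i + f j)
  set h : ℕ → ℕ → ℝ := fun i j => (f (i+1) - f i) - (f (j+1) - f j) with hh
  have e1 : Eb (n+1) h = 0 := by
    have a := Eb_sub (n+1) (fun i _ => f (i+1) - f i) (fun _ j => f (j+1) - f j)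
    have b := Eb_swap (n+1) (fun i _ => f (i+1) - f i)
    rw [hh]; linarith
  have h2 := Vb_poincare n h
  have e2 : Vb (n+1) h = Eb (n+1) (fun i j => ((f (i+1) + f j) - (f i + f (j+1)))^2) := by
    unfold Vb; rw [e1]
    simp only [hh]
    have : (fun i j => (f (i+1) - f i - (f (j+1) - f j))^2) = (fun i j => ((f (i+1) + f j) - (f i + f (j+1)))^2) := by
      funext i j; ring
    rw [this]; ring
  set g : ℕ → ℝ := fun i => (f (i+2) - 2 * f (i+1) + f i)^2 with hg
  have h3 : Eb n (fun i j => (h (i+1) j - h i (j+1))^2) ≤ 4 * Eb n (fun i _ => g i) := by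
    have a := Eb_mono n (fun i j => (h (i+1) j - h i (j+1))^2) (fun i j => 2 * g i + 2 * g j) (by
      intro i j
      simp only [hh, hg]
      nlinarith [sq_nonneg ((f (i+2) - 2 * f (i+1) + f i) - (f (j+2) - 2 * f (j+1) + f j))])
    have b := Eb_add n (fun i _ => 2 * g i) (fun _ j => 2 * g j)
    have c := Eb_swap n (fun i _ => 2 * g i)
    have d := Eb_smul n 2 (fun i _ => g i)
    linarith
  push_cast at h1
  rw [e2] at h2
  have h4 : Eb (n+1) (fun i j => ((f (i+1) + f j) - (f i + f (j+1)))^2) ≤ (n+1)/4 * (4 * Eb n (fun i _ => g i)) :=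
    h2.trans (mul_le_mul_of_nonneg_left h3 (by positivity))
  have h5 := h1.trans (mul_le_mul_of_nonneg_left h4 (by positivity))
  refine h5.trans (le_of_eq ?_)
  ring
/-- Level probabilities of approximate counting, shifted by one level. -/
noncomputable def dd : ℕ → ℕ → ℝ
  | 0, k => if k = 1 then 1 else 0
  | _ + 1, 0 => 0
  | n + 1, k + 1 => (1 - (1/2:ℝ)^k) * dd n (k+1) + 2 * (1/2:ℝ)^k * dd n k

lemma dd_succ (n k : ℕ) : dd (n+1) (k+1) = (1 - (1/2:ℝ)^k) * dd n (k+1) + 2 * (1/2:ℝ)^k * dd n k := rfl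

lemma dd_zero (n : ℕ) : dd n 0 = 0 := by cases n <;> simp [dd]

lemma q_nonneg (k : ℕ) : (0:ℝ) ≤ (1/2:ℝ)^k := by positivity
lemma q_le (k : ℕ) : (1/2:ℝ)^k ≤ 1 := pow_le_one₀ (by norm_num) (by norm_num)
lemma q_le_half (k : ℕ) : (1/2:ℝ)^(k+1) ≤ 1/2 := by
  have := q_le k
  rw [pow_succ]; linarith

lemma dd_nonneg (n : ℕ) : ∀ k, 0 ≤ dd n k := by
  induction n with
  | zero => intro k; simp only [dd]; split_ifs <;> norm_num
  | succ n ih =>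
    intro k
    rcases k with _ | k
    · simp [dd]
    · rw [dd_succ]
      have := ih k; have := ih (k+1); have := q_nonneg k; have := sub_nonneg.2 (q_le k)
      positivity

lemma dd_one (n : ℕ) : dd (n+1) 1 = 0 := by rw [dd_succ, dd_zero]; simp

lemma dd_bin (n : ℕ) : ∀ k, dd (n+1) (k+2) = Eb n (fun i _ => dd i (k+1)) := by
  induction n with
  | zero => intro k; rw [dd_succ]; simp only [dd, Eb]; rcases k with _ | k <;> simp
  | succ n ih =>
    intro k
    have e : Eb (n+1) (fun i _ => dd i (k+1)) = (Eb n (fun i _ => dd (i+1) (k+1)) + Eb n (fun i _ => dd i (k+1)))/2 := rfl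
    have e2 : Eb n (fun i _ => dd (i+1) (k+1)) = (1 - (1/2:ℝ)^k) * Eb n (fun i _ => dd i (k+1)) + 2 * (1/2:ℝ)^k * Eb n (fun i _ => dd i k) := by
      simp only [dd_succ]
      rw [Eb_add n (fun i _ => (1 - (1/2:ℝ)^k) * dd i (k+1)) (fun i _ => 2 * (1/2:ℝ)^k * dd i k), Eb_smul, Eb_smul]
    rw [e, e2, dd_succ (n+1), ih k]
    rcases k with _ | k
    · have : Eb n (fun i _ => dd i 0) = 0 := by
        have a := Eb_smul n 0 (fun i _ => dd i 0)
        have : (fun i (_:ℕ) => dd i 0) = (fun i (_:ℕ) => 0 * dd i 0) := by funext i j; simp [dd_zero]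
        rw [this, a]; ring
      rw [this, dd_one]; norm_num; ring
    · rw [ih k, pow_succ]; ring

/-- Probability of level at most `K`. -/
noncomputable def QQ (n K : ℕ) : ℝ := ∑ k ∈ Finset.range (K+1), dd n (k+1)

lemma QQ_succ_right (n K : ℕ) : QQ n (K+1) = QQ n K + dd n (K+2) := by
  unfold QQ; rw [Finset.sum_range_succ]

lemma QQ_zero_right (n : ℕ) : QQ n 0 = dd n 1 := by simp [QQ]

lemma QQ_succ_left (n K : ℕ) : QQ (n+1) K = QQ n K - (1/2:ℝ)^K * dd n (K+1) := by
  induction K with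
  | zero => rw [QQ_zero_right, QQ_zero_right, dd_one]; simp
  | succ K ih => rw [QQ_succ_right, QQ_succ_right, ih, dd_succ, pow_succ]; ring

lemma QQ_nonneg (n K : ℕ) : 0 ≤ QQ n K := Finset.sum_nonneg (fun _ _ => dd_nonneg _ _)

lemma QQ_zero_left (K : ℕ) : QQ 0 K = 1 := by
  induction K with
  | zero => simp [QQ, dd]
  | succ K ih => rw [QQ_succ_right, ih]; simp [dd]

lemma QQ_anti (K : ℕ) : Antitone (fun n => QQ n K) := by
  apply antitone_nat_of_succ_le
  intro n
  rw [QQ_succ_left]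
  have := mul_nonneg (q_nonneg K) (dd_nonneg n (K+1))
  linarith

lemma dd_le_QQ (n K : ℕ) : dd n (K+1) ≤ QQ n K := by
  rcases K with _ | K
  · rw [QQ_zero_right]
  · rw [QQ_succ_right]; linarith [QQ_nonneg n K]

lemma dd_le_one (n k : ℕ) : dd n k ≤ 1 := by
  rcases k with _ | k
  · rw [dd_zero]; norm_num
  · have := QQ_anti k (Nat.zero_le n)
    simp only [QQ_zero_left] at this
    exact (dd_le_QQ n k).trans this

/-- Partial sums over time. -/
noncomputable def AA (m k : ℕ) : ℝ := ∑ s ∈ Finset.range m, dd s k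

lemma AA_succ (m k : ℕ) : AA (m+1) k = AA m k + dd m k := by unfold AA; rw [Finset.sum_range_succ]
lemma AA_zero (k : ℕ) : AA 0 k = 0 := by simp [AA]
lemma AA_nonneg (m k : ℕ) : 0 ≤ AA m k := Finset.sum_nonneg (fun _ _ => dd_nonneg _ _)

lemma AA_QQ (m k : ℕ) : (1/2:ℝ)^k * AA m (k+1) + QQ m k = 1 := by
  induction m with
  | zero => rw [AA_zero, QQ_zero_left]; ring
  | succ m ih => rw [AA_succ, QQ_succ_left]; linarith

lemma two_q (k : ℕ) : (2:ℝ)^k * (1/2:ℝ)^k = 1 := by rw [← mul_pow]; norm_num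

lemma AA_le (m k : ℕ) : AA m (k+1) ≤ 2^k := by
  have h := AA_QQ m k
  have h1 := QQ_nonneg m k
  have h2 := two_q k
  have h3 : (0:ℝ) < 2^k := by positivity
  have h4 : (1/2:ℝ)^k * AA m (k+1) ≤ 1 := by linarith
  calc AA m (k+1) = 2^k * ((1/2:ℝ)^k * AA m (k+1)) := by rw [← mul_assoc, h2, one_mul]
    _ ≤ 2^k * 1 := by gcongr
    _ = _ := by ring

noncomputable def MM (m k : ℕ) : ℝ := ∑ s ∈ Finset.range m, ((s:ℝ)+1) * dd s k

lemma MM_succ (m k : ℕ) : MM (m+1) k = MM m k + ((m:ℝ)+1) * dd m k := by unfold MM; rw [Finset.sum_range_succ]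

lemma MM_id (m k : ℕ) : (1/2:ℝ)^k * MM m (k+1) + m * dd m (k+1) = 2 * (1/2:ℝ)^k * MM m k + AA m (k+1) := by
  induction m with
  | zero => simp [MM, AA]
  | succ m ih =>
    rw [MM_succ, MM_succ, AA_succ, dd_succ]
    push_cast
    linear_combination ih

lemma MM_le (m : ℕ) : ∀ k, MM m (k+1) ≤ 2 * 4^k := by
  have step : ∀ k, MM m (k+1) ≤ 2 * MM m k + 4^k := by
    intro k
    have h := MM_id m k
    have h1 := AA_le m k
    have h2 := two_q k
    have h3 : 0 ≤ (m:ℝ) * dd m (k+1) := mul_nonneg (by positivity) (dd_nonneg _ _)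
    have h4 : (1/2:ℝ)^k * MM m (k+1) ≤ 2 * (1/2:ℝ)^k * MM m k + 2^k := by linarith
    calc MM m (k+1) = 2^k * ((1/2:ℝ)^k * MM m (k+1)) := by rw [← mul_assoc, h2, one_mul]
      _ ≤ 2^k * (2 * (1/2:ℝ)^k * MM m k + 2^k) := by gcongr
      _ = 2 * (2^k * (1/2:ℝ)^k) * MM m k + (2*2)^k := by rw [mul_pow]; ring
      _ = _ := by rw [h2]; norm_num
  intro k
  induction k with
  | zero =>
    have h := step 0
    have : MM m 0 = 0 := by simp [MM, dd_zero]
    rw [this] at h; norm_num at h ⊢; linarith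
  | succ k ih =>
    have h := step (k+1)
    rw [pow_succ] at h ⊢
    linarith

lemma sumQ_le (m k : ℕ) : ∑ s ∈ Finset.range m, ((s:ℝ)+1) * QQ s k ≤ 3 * 4^k := by
  induction k with
  | zero =>
    have := MM_le m 0
    simp only [QQ_zero_right]
    unfold MM at this
    norm_num at this ⊢; linarith
  | succ k ih =>
    have := MM_le m (k+1)
    unfold MM at this
    have e : ∑ s ∈ Finset.range m, ((s:ℝ)+1) * QQ s (k+1) = ∑ s ∈ Finset.range m, ((s:ℝ)+1) * QQ s k + ∑ s ∈ Finset.range m, ((s:ℝ)+1) * dd s (k+1+1) := by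
      rw [← Finset.sum_add_distrib]
      apply Finset.sum_congr rfl
      intro s _
      rw [QQ_succ_right]; ring
    have p : (0:ℝ) ≤ 4^k := by positivity
    rw [e]
    rw [pow_succ] at *
    linarith

lemma QQ_decay (m k : ℕ) : (m:ℝ)^2 * QQ m k ≤ 6 * 4^k := by
  have h := sumQ_le m k
  have h2 : ∀ r : ℕ, ((r:ℝ)^2) ≤ 2 * ∑ s ∈ Finset.range r, ((s:ℝ)+1) := by
    intro r
    induction r with
    | zero => simp
    | succ r ih => rw [Finset.sum_range_succ]; push_cast; nlinarith
  have h3 : (∑ s ∈ Finset.range m, ((s:ℝ)+1)) * QQ m k ≤ ∑ s ∈ Finset.range m, ((s:ℝ)+1) * QQ s k := by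
    rw [Finset.sum_mul]
    apply Finset.sum_le_sum
    intro s hs
    apply mul_le_mul_of_nonneg_left _ (by positivity)
    exact QQ_anti k (Finset.mem_range.1 hs).le
  have h4 := mul_le_mul_of_nonneg_right (h2 m) (QQ_nonneg m k)
  linarith

lemma dd_upper (m k : ℕ) : dd m (k+1) ≤ dd 0 (k+1) + 2 * (1/2:ℝ)^k * AA m k := by
  induction m with
  | zero => rw [AA_zero]; linarith
  | succ m ih =>
    rw [AA_succ, dd_succ]
    have := mul_nonneg (q_nonneg k) (dd_nonneg m (k+1))
    linarith

lemma dd_lower (m k : ℕ) : (1 - (1/2:ℝ)^k)^m * (2 * (1/2:ℝ)^k * AA m k) ≤ dd m (k+1) := by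
  induction m with
  | zero => rw [AA_zero]; simpa using dd_nonneg 0 (k+1)
  | succ m ih =>
    rw [AA_succ, dd_succ]
    have h0 := sub_nonneg.2 (q_le k)
    have h1 := mul_le_mul_of_nonneg_left ih h0
    have h2 : (1 - (1/2:ℝ)^k)^(m+1) ≤ 1 := pow_le_one₀ h0 (by linarith [q_nonneg k])
    have h3 := mul_le_mul_of_nonneg_right h2 (mul_nonneg (mul_nonneg zero_le_two (q_nonneg k)) (dd_nonneg m k))
    rw [pow_succ] at *
    linarith

lemma AA_rec (m k : ℕ) : AA (m+1) (k+1) = dd 0 (k+1) + (1 - (1/2:ℝ)^k) * AA m (k+1) + 2 * (1/2:ℝ)^k * AA m k := by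
  induction m with
  | zero => rw [AA_succ, AA_zero, AA_zero]; ring
  | succ m ih => 
    have s := AA_succ m (k+1)
    rw [AA_succ (m+1), AA_succ m k, dd_succ]
    linear_combination ih - (1 - (1/2:ℝ)^k) * s

lemma newton (m : ℕ) : ∀ k : ℕ, ((m:ℝ) - k + 1) * dd m k ≤ k * AA m k := by
  induction m with
  | zero =>
    intro k
    rw [AA_zero]
    simp only [dd]
    split_ifs with h
    · subst h; simp
    · simp
  | succ m ih =>
    intro k
    rcases k with _ | k
    · simp [dd_zero]
    · have i1 := ih k
      have i2 := ih (k+1)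
      have h0 := sub_nonneg.2 (q_le k)
      have j1 := mul_le_mul_of_nonneg_left i1 (mul_nonneg zero_le_two (q_nonneg k))
      have j2 := mul_le_mul_of_nonneg_left i2 h0
      have u := dd_upper m k
      have v := mul_nonneg (q_nonneg k) (dd_nonneg m (k+1))
      have w : 0 ≤ (k:ℝ) * dd 0 (k+1) := mul_nonneg (by positivity) (dd_nonneg _ _)
      rw [AA_rec, dd_succ]
      push_cast at *
      linarith

lemma pow_lower (k : ℕ) : (1/4:ℝ) ≤ (1 - (1/2:ℝ)^(k+1))^(2^(k+1)) := by
  induction k with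
  | zero => norm_num
  | succ k ih =>
    refine ih.trans ?_
    rw [pow_succ 2 (k+1), mul_comm (2^(k+1)) 2, pow_mul]
    apply pow_le_pow_left₀ (by linarith [q_le (k+1)])
    rw [pow_succ (1/2:ℝ) (k+1)]
    nlinarith [sq_nonneg ((1/2:ℝ)^(k+1))]

lemma qA_le (m k : ℕ) (hm : m ≤ 2^(k+2)) : (1/2:ℝ)^(k+1) * AA m (k+1) ≤ 8 * dd m (k+2) := by
  have h := dd_lower m (k+1)
  have h1 : (1/16:ℝ) ≤ (1 - (1/2:ℝ)^(k+1))^m := by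
    calc (1/16:ℝ) = (1/4)^2 := by norm_num
      _ ≤ ((1 - (1/2:ℝ)^(k+1))^(2^(k+1)))^2 := pow_le_pow_left₀ (by norm_num) (pow_lower k) 2
      _ = (1 - (1/2:ℝ)^(k+1))^(2^(k+2)) := by rw [← pow_mul, pow_succ 2 (k+1)]
      _ ≤ _ := pow_le_pow_of_le_one (by linarith [q_le (k+1)]) (by linarith [q_nonneg (k+1)]) hm
  have h2 := mul_le_mul_of_nonneg_right h1 (mul_nonneg (mul_nonneg zero_le_two (q_nonneg (k+1))) (AA_nonneg m (k+1)))
  linarith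

lemma dd_half (m k : ℕ) : dd m (k+2) ≤ 2 * dd (m+1) (k+2) := by
  rw [dd_succ]
  have h := mul_le_mul_of_nonneg_right (q_le_half k) (dd_nonneg m (k+2))
  have h2 := mul_nonneg (q_nonneg (k+1)) (dd_nonneg m (k+1))
  linarith

lemma lemR' (m k : ℕ) (hm : m ≤ 2^(k+2)) :
    ((m:ℝ) - k) * (1/2:ℝ)^(k+1) * dd m (k+1) ≤ 8 * (k+1) * dd m (k+2) := by
  have h1 := newton m (k+1)
  have h2 := qA_le m k hm
  have h3 := mul_le_mul_of_nonneg_left h1 (q_nonneg (k+1))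
  have h4 := mul_le_mul_of_nonneg_left h2 (show (0:ℝ) ≤ k+1 by positivity)
  push_cast at *
  linarith

lemma lemR (m k : ℕ) (hm : m ≤ 2^(k+1)) :
    ((m:ℝ)+1) * (1/2:ℝ)^k * dd m k ≤ 17 * k * dd (m+1) (k+1) := by
  rcases k with _ | k
  · simp [dd_zero]
  · have h1 := lemR' m k hm
    have h2 := dd_half m k
    have h3 := mul_le_mul_of_nonneg_left h2 (show (0:ℝ) ≤ 8*(k+1) by positivity)
    have h4 : 2 * (1/2:ℝ)^(k+1) * dd m (k+1) ≤ dd (m+1) (k+2) := by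
      rw [dd_succ]
      have := mul_nonneg (sub_nonneg.2 (q_le (k+1))) (dd_nonneg m (k+2))
      linarith
    have h5 := mul_le_mul_of_nonneg_left h4 (show (0:ℝ) ≤ (k+1) by positivity)
    have h6 := mul_nonneg (show (0:ℝ) ≤ (k+1) by positivity) (dd_nonneg (m+1) (k+2))
    have h7 := mul_nonneg (show (0:ℝ) ≤ (k+1) by positivity) (mul_nonneg (q_nonneg (k+1)) (dd_nonneg m (k+1)))
    push_cast at *
    linarith

lemma tp2 (e m : ℕ) : ∀ i j, i ≤ j → dd m j * dd (m+e) i ≤ dd (m+e) j * dd m i := by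
  induction m with
  | zero =>
    intro i j hij
    rw [Nat.zero_add]
    by_cases hj : j = 1
    · subst hj
      interval_cases i
      · simp [dd_zero]
      · linarith [mul_comm (dd 0 1) (dd e 1)]
    · have : dd 0 j = 0 := by simp [dd, hj]
      rw [this, zero_mul]
      exact mul_nonneg (dd_nonneg _ _) (dd_nonneg _ _)
  | succ m ih =>
    intro i j hij
    rcases i with _ | i
    · simp [dd_zero]
    · rcases Nat.eq_or_lt_of_le hij with h | hlt
      · rw [← h, mul_comm]
      obtain ⟨j, rfl⟩ : ∃ j', j = j' + 1 := ⟨j-1, by omega⟩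
      rw [show m + 1 + e = (m+e)+1 by ring, dd_succ, dd_succ, dd_succ, dd_succ]
      have a1 := sub_nonneg.2 (q_le j)
      have a2 := sub_nonneg.2 (q_le i)
      have a3 := mul_nonneg zero_le_two (q_nonneg j)
      have a4 := mul_nonneg zero_le_two (q_nonneg i)
      have b1 := mul_le_mul_of_nonneg_left (ih (i+1) (j+1) hij) (mul_nonneg a1 a2)
      have b2 := mul_le_mul_of_nonneg_left (ih i (j+1) (by omega)) (mul_nonneg a1 a4)
      have b4 := mul_le_mul_of_nonneg_left (ih i j (by omega)) (mul_nonneg a3 a4)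
      have b3 : (2 * (1/2:ℝ)^j * (1 - (1/2:ℝ)^i)) * (dd m j * dd (m+e) (i+1)) ≤ (2 * (1/2:ℝ)^j * (1 - (1/2:ℝ)^i)) * (dd (m+e) j * dd m (i+1)) := by
        exact mul_le_mul_of_nonneg_left (ih (i+1) j (by omega)) (mul_nonneg a3 a2)
      linarith
lemma dd_pos (m : ℕ) : ∀ k, k + 1 ≤ m → 0 < dd m (k+2) := by
  induction m with
  | zero => intro k h; omega
  | succ m ih =>
    intro k h
    rw [dd_succ]
    have h1 : 0 < 1 - (1/2:ℝ)^(k+1) := by linarith [q_le_half k]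
    have h2 : 0 < 2 * (1/2:ℝ)^(k+1) := by positivity
    rcases Nat.lt_or_ge k m with hk | hk
    · have := mul_pos h1 (ih k hk)
      have := mul_nonneg h2.le (dd_nonneg m (k+1))
      linarith
    · have hm : m = k := by omega
      have h3 := mul_nonneg h1.le (dd_nonneg m (k+2))
      have h4 : 0 < dd m (k+1) := by
        rcases k with _ | k
        · subst hm; simp [dd]
        · exact ih k (by omega)
      have := mul_pos h2 h4
      linarith

lemma lemR2 (m k : ℕ) (hm : 2^k ≤ m) : dd m k ≤ 16 * k * dd m (k+1) := by
  rcases k with _ | k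
  · simp [dd_zero]
  rcases k with _ | k
  · obtain ⟨m, rfl⟩ : ∃ m', m = m' + 1 := ⟨m-1, by simp at hm; omega⟩
    rw [dd_one]
    have := dd_nonneg (m+1) 2
    push_cast; norm_num; linarith
  set M := 2^(k+1+1) with hM
  have hlt : k + 1 < 2^(k+1) := Nat.lt_two_pow_self
  have hM2 : M = 2 * 2^(k+1) := by rw [hM, pow_succ]; ring
  have h1 := lemR' M (k+1) (by rw [hM]; exact Nat.pow_le_pow_right (by norm_num) (by omega))
  have hpos : 0 < dd M (k+2) := dd_pos M k (by omega)
  have hq : (M:ℝ) * (1/2:ℝ)^(k+1+1) = 1 := by rw [hM]; push_cast; exact two_q _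
  have hge : (M:ℝ)/2 ≤ (M:ℝ) - (k+1:ℕ) := by
    have : (M:ℝ) = 2 * 2^(k+1) := by rw [hM2]; push_cast; ring
    have h' : ((k+1:ℕ):ℝ) ≤ 2^(k+1) := by exact_mod_cast hlt.le
    linarith
  have h2 : dd M (k+2) ≤ 16 * (k+2) * dd M (k+3) := by
    have a := mul_le_mul_of_nonneg_right hge (mul_nonneg (q_nonneg (k+1+1)) hpos.le)
    have b : (M:ℝ)/2 * ((1/2:ℝ)^(k+1+1) * dd M (k+2)) = dd M (k+2) / 2 := by
      linear_combination (dd M (k+2) / 2) * hq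
    push_cast at *
    linarith
  obtain ⟨e, rfl⟩ := Nat.exists_eq_add_of_le hm
  have h3 := tp2 e M (k+2) (k+3) (by omega)
  have h4 := mul_le_mul_of_nonneg_right h2 (dd_nonneg (M+e) (k+2))
  have h5 := mul_le_mul_of_nonneg_left h3 (show (0:ℝ) ≤ 16 * (k+2) by positivity)
  refine le_of_mul_le_mul_left (a := dd M (k+2)) ?_ hpos
  push_cast
  linarith

lemma main_small (m j : ℕ) (hm : m ≤ 2^(j+1)) :
    (((m:ℝ)+1) * (1/2:ℝ)^(j+1))^2 * (8 * dd m j + 6 * dd m (j+1) + dd m (j+2))^2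
      ≤ 10^8 * ((j:ℝ)+1)^2 * dd (m+2) (j+2) := by
  set y := ((m:ℝ)+1) * (1/2:ℝ)^(j+1) with hy
  have y0 : 0 ≤ y := by positivity
  have y2 : y ≤ 2 := by
    have h1 : ((m:ℝ)+1) ≤ 2 * 2^(j+1) := by
      have : (m:ℝ) ≤ 2^(j+1) := by exact_mod_cast hm
      have : (1:ℝ) ≤ 2^(j+1) := one_le_pow₀ (by norm_num)
      linarith
    have h2 := mul_le_mul_of_nonneg_right h1 (q_nonneg (j+1))
    have := two_q (j+1)
    nlinarith
  set D0 := dd m j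
  set D1 := dd m (j+1)
  set D2 := dd m (j+2)
  set E1 := dd (m+1) (j+1)
  set E2 := dd (m+1) (j+2)
  set X := dd (m+2) (j+2)
  have p0 : 0 ≤ D0 := dd_nonneg _ _
  have p1 : 0 ≤ D1 := dd_nonneg _ _
  have p2 : 0 ≤ D2 := dd_nonneg _ _
  have pX : 0 ≤ X := dd_nonneg _ _
  have pE1 : 0 ≤ E1 := dd_nonneg _ _
  have l0 : D0 ≤ 1 := dd_le_one _ _
  have l1 : D1 ≤ 1 := dd_le_one _ _
  have l2 : D2 ≤ 1 := dd_le_one _ _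
  have r1 : y * D1 ≤ 17 * ((j:ℝ)+1) * E2 := by
    have := lemR m (j+1) (hm.trans (Nat.pow_le_pow_right (by norm_num) (by omega)))
    push_cast at this; exact this
  have r0 : 2 * y * D0 ≤ 17 * ((j:ℝ)+1) * E1 := by
    have a := lemR m j hm
    have b : 2 * y = ((m:ℝ)+1) * (1/2:ℝ)^j := by rw [hy, pow_succ]; ring
    rw [b]; linarith
  have r2 : y * E1 ≤ 17 * ((j:ℝ)+1) * X := by
    have a := lemR (m+1) (j+1) (by rw [pow_succ 2 (j+1)]; have : 0 < 2^(j+1) := by positivity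
                                   omega)
    have b : y ≤ ((m+1:ℕ):ℝ)+1 := by
      rw [hy]; push_cast
      have := mul_le_mul_of_nonneg_left (q_le (j+1)) (show (0:ℝ) ≤ (m:ℝ)+1 by positivity)
      linarith
    have c : y ≤ (((m+1:ℕ):ℝ)+1) * (1/2:ℝ)^(j+1) := by
      rw [hy]; push_cast
      exact mul_le_mul_of_nonneg_right (by linarith) (q_nonneg _)
    have d := mul_le_mul_of_nonneg_right c pE1
    push_cast at a d ⊢
    linarith
  have s1 : E2 ≤ 2 * X := dd_half (m+1) j
  have s2 : D2 ≤ 2 * E2 := dd_half m j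
  have J1 : (1:ℝ) ≤ (j:ℝ)+1 := by linarith [show (0:ℝ) ≤ j by positivity]
  set J := (j:ℝ)+1
  have JX : J * X ≤ J^2 * X := mul_le_mul_of_nonneg_right (by nlinarith) pX
  have JX' : X ≤ J * X := by nlinarith
  have t0 : y^2 * D0 ≤ 145 * (J^2 * X) := by
    have a := mul_le_mul_of_nonneg_left r0 y0
    have b := mul_le_mul_of_nonneg_left r2 (show 0 ≤ 17 * J by positivity)
    nlinarith
  have t1 : y^2 * D1 ≤ 68 * (J^2 * X) := by
    have a := mul_le_mul_of_nonneg_left r1 y0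
    have b := mul_le_mul_of_nonneg_left s1 (show 0 ≤ 17 * J by positivity)
    have c : y * (17 * J * E2) ≤ 2 * (17 * J * E2) := mul_le_mul_of_nonneg_right y2 (mul_nonneg (by positivity) (dd_nonneg _ _))
    nlinarith
  have t2 : y^2 * D2 ≤ 16 * (J^2 * X) := by
    have a : y^2 ≤ 4 := by nlinarith
    have b := mul_le_mul_of_nonneg_right a p2
    linarith
  set Z := 8 * D0 + 6 * D1 + D2 with hZ
  have z0 : 0 ≤ Z := by positivity
  have z15 : Z ≤ 15 := by linarith
  have t3 : y^2 * Z ≤ 1584 * (J^2 * X) := by rw [hZ]; linarith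
  have t4 := mul_le_mul_of_nonneg_right z15 (mul_nonneg (sq_nonneg y) z0)
  have pp : 0 ≤ J^2 * X := by positivity
  nlinarith

lemma main_large (m j : ℕ) (hm : 2^(j+1) ≤ m) :
    (((m:ℝ)+1) * (1/2:ℝ)^(j+1))^2 * (8 * dd m j + 6 * dd m (j+1) + dd m (j+2))^2
      ≤ 10^9/2 * ((j:ℝ)+1)^4 * dd (m+2) (j+2) := by
  set y := ((m:ℝ)+1) * (1/2:ℝ)^(j+1) with hy
  have m1 : 1 ≤ m := le_trans Nat.one_le_two_pow hm
  have hyD : y^2 * dd m (j+2) ≤ 24 := by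
    have h1 := (mul_le_mul_of_nonneg_left (dd_le_QQ m (j+1)) (sq_nonneg (m:ℝ))).trans (QQ_decay m (j+1))
    have m1' : (1:ℝ) ≤ m := by exact_mod_cast m1
    have h2 : ((m:ℝ)+1)^2 ≤ 4 * (m:ℝ)^2 := by nlinarith
    have h3 := mul_le_mul_of_nonneg_right h2 (dd_nonneg m (j+2))
    have h4 : ((m:ℝ)+1)^2 * dd m (j+2) ≤ 24 * 4^(j+1) := by linarith
    have h5 := mul_le_mul_of_nonneg_left h4 (sq_nonneg ((1/2:ℝ)^(j+1)))
    have h6 : ((1/2:ℝ)^(j+1))^2 * (24 * 4^(j+1)) = 24 := by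
      have : (4:ℝ)^(j+1) = (2^(j+1))^2 := by rw [← pow_mul, mul_comm (j+1) 2, pow_mul]; norm_num
      rw [this]
      linear_combination 24 * (2^(j+1) * (1/2:ℝ)^(j+1) + 1) * two_q (j+1)
    rw [h6] at h5
    rw [hy]; linarith
  have a1 := lemR2 m (j+1) hm
  have a0 := lemR2 m j (le_trans (Nat.pow_le_pow_right (by norm_num) (by omega)) hm)
  have s1 : dd (m+1) (j+2) ≤ 2 * dd (m+2) (j+2) := dd_half (m+1) j
  have s2 : dd m (j+2) ≤ 2 * dd (m+1) (j+2) := dd_half m j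
  push_cast at a1
  set D0 := dd m j
  set D1 := dd m (j+1)
  set D2 := dd m (j+2)
  set X := dd (m+2) (j+2)
  have p0 : 0 ≤ D0 := dd_nonneg _ _
  have p1 : 0 ≤ D1 := dd_nonneg _ _
  have p2 : 0 ≤ D2 := dd_nonneg _ _
  have J1 : (1:ℝ) ≤ (j:ℝ)+1 := by linarith [show (0:ℝ) ≤ j by positivity]
  have hj : (j:ℝ) ≤ (j:ℝ)+1 := by linarith
  have a0' : D0 ≤ 16 * ((j:ℝ)+1) * D1 := a0.trans (mul_le_mul_of_nonneg_right (by linarith) p1)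
  set J := (j:ℝ)+1
  have b1 : J ≤ J^2 := by nlinarith
  have c0 : D0 ≤ 256 * J^2 * D2 := by
    have := mul_le_mul_of_nonneg_left a1 (show 0 ≤ 16 * J by positivity)
    change 16 * J * D1 ≤ 16 * J * (16 * J * D2) at this
    linarith
  have c1 : D1 ≤ 16 * J^2 * D2 := a1.trans (mul_le_mul_of_nonneg_right (by linarith) p2)
  have c2 : D2 ≤ J^2 * D2 := by nlinarith
  have hZ : 8 * D0 + 6 * D1 + D2 ≤ 2145 * J^2 * D2 := by linarith
  have hZ2 := pow_le_pow_left₀ (by positivity) hZ 2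
  have h7 := mul_le_mul_of_nonneg_left hZ2 (sq_nonneg y)
  have h8 := mul_le_mul_of_nonneg_right hyD (show 0 ≤ 2145^2 * J^4 * D2 by positivity)
  have h9 : J^4 * D2 ≤ J^4 * (4 * X) := mul_le_mul_of_nonneg_left (by linarith) (by positivity)
  have h10 : 0 ≤ J^4 * X := mul_nonneg (by positivity) (dd_nonneg _ _)
  nlinarith

lemma main_pt (m j : ℕ) :
    ((m:ℝ)+2) * (((m:ℝ)+1) * ((1/2:ℝ)^(j+1) * (8 * dd m j - 6 * dd m (j+1) + dd m (j+2)))^2)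
      ≤ 10^9 * ((j:ℝ)+1)^4 * dd (m+2) (j+2) := by
  have h : (((m:ℝ)+1) * (1/2:ℝ)^(j+1))^2 * (8 * dd m j + 6 * dd m (j+1) + dd m (j+2))^2
      ≤ 10^9/2 * ((j:ℝ)+1)^4 * dd (m+2) (j+2) := by
    rcases le_total m (2^(j+1)) with h | h
    · refine (main_small m j h).trans ?_
      apply mul_le_mul_of_nonneg_right _ (dd_nonneg _ _)
      have J1 : (1:ℝ) ≤ (j:ℝ)+1 := by linarith [show (0:ℝ) ≤ j by positivity]
      have : ((j:ℝ)+1)^2 ≤ ((j:ℝ)+1)^4 := pow_le_pow_right₀ J1 (by norm_num)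
      have : 0 ≤ ((j:ℝ)+1)^4 := by positivity
      linarith
    · exact main_large m j h
  have p0 := dd_nonneg m j
  have p1 := dd_nonneg m (j+1)
  have p2 := dd_nonneg m (j+2)
  have hs : (8 * dd m j - 6 * dd m (j+1) + dd m (j+2))^2 ≤ (8 * dd m j + 6 * dd m (j+1) + dd m (j+2))^2 := by
    nlinarith [mul_nonneg p0 p1, mul_nonneg p1 p2]
  have h2 : ((m:ℝ)+2) * ((m:ℝ)+1) ≤ 2 * ((m:ℝ)+1)^2 := by nlinarith [show (0:ℝ) ≤ m by positivity]
  have h3 := mul_le_mul h2 (mul_le_mul_of_nonneg_left hs (sq_nonneg ((1/2:ℝ)^(j+1)))) (by positivity) (by positivity)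
  nlinarith
lemma zp (n : ℕ) : (2:ℝ)^((2:ℤ) - ((n+1:ℕ):ℤ)) = 2 * (1/2:ℝ)^n := by
  rw [zpow_sub₀ (by norm_num), zpow_natCast, pow_succ, one_div, inv_pow]
  field_simp

lemma sum_Eb (n : ℕ) (F : ℕ → ℕ → ℝ) : (1/2:ℝ)^n * ∑ j ∈ Finset.range (n+1), (n.choose j : ℝ) * F j (n - j) = Eb n F := by
  rw [Eb_eq, Finset.Nat.sum_antidiagonal_eq_sum_range_succ (fun i j => (n.choose i : ℝ) * F i j)]

lemma mu_succ (n k : ℕ) : mu (n+1) (k+1) = 2 * Eb n (fun i _ => mu i k) := by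
  rw [mu, zp, ← sum_Eb]
  simp only [Nat.add_sub_cancel]
  ring

lemma nu_succ (n k : ℕ) : nu (n+1) (k+1) = 2 * Eb n (fun i _ => nu i k) + 2 * Eb n (fun i j => mu i k * mu j k) := by
  rw [nu, zp, ← sum_Eb, ← sum_Eb]
  simp only [Nat.add_sub_cancel, mul_assoc]

lemma mu_zero_succ (k : ℕ) : mu 0 (k+1) = 0 := by simp [mu]
lemma nu_zero_succ (k : ℕ) : nu 0 (k+1) = 0 := by simp [nu]

lemma mu_dd (k : ℕ) : ∀ n, mu n k = 2^k * dd n (k+1) := by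
  induction k with
  | zero =>
    intro n
    rcases n with _ | n
    · simp [mu, dd]
    · rw [dd_one]; simp [mu]
  | succ k ih =>
    intro n
    rcases n with _ | n
    · simp [mu, dd]
    · rw [mu_succ, dd_bin]
      simp only [ih]
      rw [Eb_smul]; ring

lemma mu_nonneg (n k : ℕ) : 0 ≤ mu n k := by
  rw [mu_dd]; exact mul_nonneg (by positivity) (dd_nonneg _ _)

/-- Variance. -/
noncomputable def VV (n k : ℕ) : ℝ := nu n k - (mu n k)^2

lemma VV_zero_right (n : ℕ) : VV n 0 = 0 := by
  unfold VV; rw [nu, mu]; split_ifs <;> norm_num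

lemma VV_zero_left (k : ℕ) : VV 0 (k+1) = 0 := by
  unfold VV; rw [nu_zero_succ, mu_zero_succ]; norm_num

lemma VV_succ (n k : ℕ) : VV (n+1) (k+1) = 2 * Eb n (fun i _ => VV i k) + Vb n (fun i j => mu i k + mu j k) := by
  unfold VV Vb
  rw [nu_succ, mu_succ]
  have e1 := Eb_sub n (fun i _ => nu i k) (fun i _ => (mu i k)^2)
  have e2 := Eb_add n (fun i _ => mu i k) (fun _ j => mu j k)
  have e3 := Eb_swap n (fun i _ => mu i k)
  have e4 : (fun i j => (mu i k + mu j k)^2) = (fun i j => (mu i k)^2 + ((mu j k)^2 + 2 * (mu i k * mu j k))) := by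
    funext i j; ring
  have e5 := Eb_add n (fun i _ => (mu i k)^2) (fun i j => ((mu j k)^2 + 2 * (mu i k * mu j k)))
  have e6 := Eb_add n (fun _ j => (mu j k)^2) (fun i j => 2 * (mu i k * mu j k))
  have e7 := Eb_swap n (fun i _ => (mu i k)^2)
  have e8 := Eb_smul n 2 (fun i j => (mu i k * mu j k))
  rw [e4, e5, e6, e7, e8, e1, e2, e3]
  ring

lemma second_diff (m j : ℕ) : mu (m+2) (j+1) - 2 * mu (m+1) (j+1) + mu m (j+1) =
    (1/2:ℝ)^(j+1) * (8 * dd m j - 6 * dd m (j+1) + dd m (j+2)) := by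
  have h := two_q (j+1)
  have d : ∀ s, mu (s+1) (j+1) - mu s (j+1) = 2 * dd s (j+1) - dd s (j+2) := by
    intro s
    rw [mu_dd, mu_dd, dd_succ]
    linear_combination (2 * dd s (j+1) - dd s (j+2)) * h
  have d1 := d (m+1)
  have d0 := d m
  rw [dd_succ, dd_succ m (j+1)] at d1
  have e : (1/2:ℝ)^j = 2 * (1/2:ℝ)^(j+1) := by rw [pow_succ]; ring
  rw [e] at d1
  linear_combination d1 - d0

lemma toll_le (n k : ℕ) : Vb n (fun i j => mu i k + mu j k) ≤ 10^9 * ((k:ℝ)+1)^4 * dd (n+1) (k+2) := by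
  have hd := dd_nonneg (n+1) (k+2)
  rcases k with _ | k
  · have h1 : Eb n (fun i j => (mu i 0 + mu j 0)^2) ≤ Eb n (fun i j => 2 * (mu i 0 + mu j 0)) := by
      apply Eb_mono
      intro i j
      simp only [mu]
      split_ifs <;> norm_num
    have e0 := Eb_smul n 2 (fun i j => (mu i 0 + mu j 0))
    have e2 := Eb_add n (fun i _ => mu i 0) (fun _ j => mu j 0)
    have e3 := Eb_swap n (fun i _ => mu i 0)
    have e4 := mu_succ n 0
    rw [mu_dd] at e4
    have := sq_nonneg (Eb n (fun i j => mu i 0 + mu j 0))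
    unfold Vb
    norm_num at *
    linarith
  rcases n with _ | n
  · have : Vb 0 (fun i j => mu i (k+1) + mu j (k+1)) = 0 := by simp [Vb, Eb]
    rw [this]
    exact mul_nonneg (by positivity) hd
  rcases n with _ | n
  · have : Vb 1 (fun i j => mu i (k+1) + mu j (k+1)) = 0 := by simp [Vb, Eb]; ring
    rw [this]
    exact mul_nonneg (by positivity) hd
  have h := toll_bound n (fun i => mu i (k+1))
  rw [← Eb_sizebias2 n (fun i => (mu (i+2) (k+1) - 2 * mu (i+1) (k+1) + mu i (k+1))^2)] at h
  refine h.trans ?_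
  rw [dd_bin, ← Eb_smul]
  apply Eb_mono
  intro i _
  rcases i with _ | i
  · simp only [Nat.cast_zero, zero_mul]; exact mul_nonneg (by positivity) (dd_nonneg _ _)
  rcases i with _ | i
  · simp only [Nat.cast_zero, zero_mul, mul_zero, Nat.zero_add, Nat.sub_self]; exact mul_nonneg (by positivity) (dd_nonneg _ _)
  have h2 := main_pt i k
  have s1 : i + 1 + 1 - 1 = i + 1 := by omega
  have s2 : i + 1 - 1 = i := by omega
  rw [s1, s2, second_diff]
  have h3 : 10^9 * ((k:ℝ)+1)^4 * dd (i+2) (k+2) ≤ 10^9 * (((k+1:ℕ):ℝ)+1)^4 * dd (i+2) (k+2) := by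
    apply mul_le_mul_of_nonneg_right _ (dd_nonneg _ _)
    push_cast
    gcongr
    linarith
  refine le_trans (le_of_eq ?_) (h2.trans h3)
  push_cast
  ring

lemma poly_exp : ∃ C : ℝ, 0 < C ∧ ∀ k : ℕ, ((k:ℝ)+1)^4 ≤ C * (3/2:ℝ)^k := by
  have h := tendsto_pow_const_div_const_pow_of_one_lt 4 (show (1:ℝ) < 3/2 by norm_num)
  obtain ⟨B, hB⟩ := h.bddAbove_range
  refine ⟨(|B|+1) * (3/2), by positivity, fun k => ?_⟩
  have h1 := hB ⟨k+1, rfl⟩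
  simp only at h1
  rw [div_le_iff₀ (by positivity)] at h1
  push_cast at h1
  have h2 : (0:ℝ) < (3/2)^(k+1) := by positivity
  have h3 := mul_le_mul_of_nonneg_right ((le_abs_self B).trans (by linarith : |B| ≤ |B|+1)) h2.le
  rw [pow_succ (3/2:ℝ)] at h1 h3
  linarith

lemma VV_upper : ∃ C : ℝ, 0 < C ∧ ∀ n k, VV n k ≤ C * mu n k := by
  obtain ⟨C, hC, h⟩ := poly_exp
  set K : ℝ := 2 * 10^9 * C with hK
  have hK0 : 0 < K := by positivity
  have main : ∀ k n, VV n k ≤ K * (mu n k - (3/2:ℝ)^k * dd n (k+1)) := by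
    intro k
    induction k with
    | zero => intro n; rw [VV_zero_right, mu_dd]; simp
    | succ k ih =>
      intro n
      rcases n with _ | n
      · rw [VV_zero_left, mu_zero_succ]; simp [dd]
      · rw [VV_succ, mu_succ]
        have h1 := toll_le n k
        have h2 := Eb_mono n (fun i _ => VV i k) (fun i _ => K * (mu i k - (3/2:ℝ)^k * dd i (k+1))) (fun i _ => ih i)
        rw [Eb_smul n K (fun i _ => mu i k - (3/2:ℝ)^k * dd i (k+1)), Eb_sub n (fun i _ => mu i k) (fun i _ => (3/2:ℝ)^k * dd i (k+1)), Eb_smul n _ (fun i _ => dd i (k+1)), ← dd_bin] at h2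
        have hd := dd_nonneg (n+1) (k+2)
        have h3 := mul_le_mul_of_nonneg_right (h k) hd
        have h4 : Vb n (fun i j => mu i k + mu j k) ≤ K / 2 * (3/2:ℝ)^k * dd (n+1) (k+2) := by
          rw [hK]; linarith
        rw [pow_succ]
        linarith
  refine ⟨K, hK0, fun n k => (main k n).trans ?_⟩
  apply mul_le_mul_of_nonneg_left _ hK0.le
  have := mul_nonneg (show (0:ℝ) ≤ (3/2)^k by positivity) (dd_nonneg n (k+1))
  linarith

lemma VV_ge (n k : ℕ) : 2 * Eb n (fun i _ => VV i k) ≤ VV (n+1) (k+1) := by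
  rw [VV_succ]; linarith [Vb_nonneg n (fun i j => mu i k + mu j k)]

lemma VV_nonneg (k : ℕ) : ∀ n, 0 ≤ VV n k := by
  induction k with
  | zero => intro n; rw [VV_zero_right]
  | succ k ih =>
    intro n
    rcases n with _ | n
    · rw [VV_zero_left]
    · have := Eb_nonneg n (fun i _ => VV i k) (fun i _ => ih i)
      linarith [VV_ge n k]

lemma nu_ge (k : ℕ) : ∀ n, mu n k ≤ nu n k := by
  induction k with
  | zero => intro n; simp [mu, nu]
  | succ k ih =>
    intro n
    rcases n with _ | n
    · rw [mu_zero_succ, nu_zero_succ]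
    · rw [mu_succ, nu_succ]
      have h1 := Eb_mono n (fun i _ => mu i k) (fun i _ => nu i k) (fun i _ => ih i)
      have h2 := Eb_nonneg n (fun i j => mu i k * mu j k) (fun i j => mul_nonneg (mu_nonneg _ _) (mu_nonneg _ _))
      linarith

lemma VV_ge_mu (n k : ℕ) : mu n k - (mu n k)^2 ≤ VV n k := by
  unfold VV; linarith [nu_ge k n]

lemma Eb_last (n : ℕ) : ∀ F : ℕ → ℕ → ℝ, (∀ i j, 0 ≤ F i j) → 0 < F n 0 → 0 < Eb n F := by
  induction n with
  | zero => intro F _ h; exact h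
  | succ n ih =>
    intro F h0 h
    simp only [Eb]
    have h1 := ih (fun i j => F (i+1) j) (fun i j => h0 _ _) h
    have h2 := Eb_nonneg n (fun i j => F i (j+1)) (fun i j => h0 _ _)
    linarith

lemma VV_pos_step (n k : ℕ) (h : 0 < VV n k) : 0 < VV (n+1) (k+1) := by
  have := Eb_last n (fun i _ => VV i k) (fun i _ => VV_nonneg k i) h
  linarith [VV_ge n k]

lemma VV_pos1 (n : ℕ) : 0 < VV (n+3) 1 := by
  have h : ∀ n, dd (n+3) 2 ≤ 1/4 := by
    intro n
    induction n with
    | zero => simp [dd]; norm_num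
    | succ n ih => rw [show n+1+3 = (n+3)+1 by ring, dd_succ, dd_one]; norm_num; linarith
  have h1 := dd_pos (n+3) 0 (by omega)
  have h2 := VV_ge_mu (n+3) 1
  rw [mu_dd] at h2
  have := h n
  norm_num at *
  nlinarith

lemma VV_pos3 (n : ℕ) : 0 < VV (n+3) 3 := by
  have key : ∀ k, mu 2 k + mu 0 k ≠ mu 1 k + mu 1 k → 0 < VV 3 (k+1) := by
    intro k hk
    rw [VV_succ]
    have h1 := Eb_nonneg 2 (fun i _ => VV i k) (fun i _ => VV_nonneg k i)
    have h2 : 0 < Vb 2 (fun i j => mu i k + mu j k) := by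
      have e : Vb 2 (fun i j => mu i k + mu j k) = ((mu 2 k + mu 0 k) - (mu 1 k + mu 1 k))^2/4 := by
        simp [Vb, Eb]; ring
      rw [e]
      have := sq_pos_of_ne_zero (sub_ne_zero.2 hk)
      linarith
    linarith
  rcases n with _ | n
  · apply key
    simp only [mu_dd]; simp [dd]
  rcases n with _ | n
  · apply VV_pos_step
    apply key
    simp only [mu_dd]; simp [dd]; norm_num
  · exact VV_pos_step _ _ (VV_pos_step _ _ (VV_pos1 n))

lemma VV_lower3 : ∃ c : ℝ, 0 < c ∧ ∀ n, c * mu n 3 ≤ VV n 3 := by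
  have fin : ∀ N : ℕ, ∃ c : ℝ, 0 < c ∧ ∀ n < N, c * mu n 3 ≤ VV n 3 := by
    intro N
    induction N with
    | zero => exact ⟨1, one_pos, fun n h => by omega⟩
    | succ N ih =>
      obtain ⟨c, hc, h⟩ := ih
      obtain ⟨c', hc', h'⟩ : ∃ c' : ℝ, 0 < c' ∧ c' * mu N 3 ≤ VV N 3 := by
        rcases Nat.lt_or_ge N 3 with hN | hN
        · refine ⟨1, one_pos, ?_⟩
          have : mu N 3 = 0 := by
            rw [mu_dd]
            interval_cases N <;> simp [dd]
          rw [this]; simpa using VV_nonneg 3 N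
        · obtain ⟨r, rfl⟩ : ∃ r, N = r + 3 := ⟨N-3, by omega⟩
          have hp := VV_pos3 r
          have hm := mu_nonneg (r+3) 3
          refine ⟨VV (r+3) 3 / (mu (r+3) 3 + 1), by positivity, ?_⟩
          rw [div_mul_eq_mul_div, div_le_iff₀ (by positivity)]
          nlinarith
      refine ⟨min c c', lt_min hc hc', fun n hn => ?_⟩
      rcases Nat.lt_succ_iff_lt_or_eq.1 hn with h1 | h1
      · exact (mul_le_mul_of_nonneg_right (min_le_left _ _) (mu_nonneg _ _)).trans (h n h1)
      · subst h1
        exact (mul_le_mul_of_nonneg_right (min_le_right _ _) (mu_nonneg _ _)).trans h'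
  obtain ⟨c, hc, h⟩ := fin 100
  refine ⟨min c (1/2), lt_min hc (by norm_num), fun n => ?_⟩
  rcases Nat.lt_or_ge n 100 with hn | hn
  · exact (mul_le_mul_of_nonneg_right (min_le_left _ _) (mu_nonneg _ _)).trans (h n hn)
  · refine (mul_le_mul_of_nonneg_right (min_le_right _ _) (mu_nonneg _ _)).trans ?_
    have h1 := VV_ge_mu n 3
    have h2 : mu n 3 ≤ 1/2 := by
      have a := QQ_decay n 3
      have b := dd_le_QQ n 3
      have q := QQ_nonneg n 3
      have hn' : (100:ℝ) ≤ n := by exact_mod_cast hn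
      have d : (100:ℝ)^2 ≤ (n:ℝ)^2 := by gcongr
      have e := mul_le_mul_of_nonneg_right d q
      rw [mu_dd]
      norm_num at *
      linarith
    have h3 := mu_nonneg n 3
    nlinarith

lemma VV_lower : ∃ c : ℝ, 0 < c ∧ ∀ k n, c * mu n (k+3) ≤ VV n (k+3) := by
  obtain ⟨c, hc, h⟩ := VV_lower3
  refine ⟨c, hc, fun k => ?_⟩
  induction k with
  | zero => exact h
  | succ k ih =>
    intro n
    rcases n with _ | n
    · rw [show k+1+3 = (k+3)+1 by ring, mu_zero_succ, VV_zero_left]; simp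
    · rw [show k+1+3 = (k+3)+1 by ring, mu_succ]
      have h1 := Eb_mono n (fun i _ => c * mu i (k+3)) (fun i _ => VV i (k+3)) (fun i _ => ih i)
      rw [Eb_smul n c (fun i _ => mu i (k+3))] at h1
      linarith [VV_ge n (k+3)]

/-- For `0 ≤ k ≤ n`, `E(B_{n,k}) → ∞` iff `Var(B_{n,k}) → ∞`. -/
theorem mean_tendsto_iff_variance_tendsto :
    ∀ k : ℕ → ℕ, (∀ n, k n ≤ n) →
    (Tendsto (fun n => mu n (k n)) atTop atTop ↔
      Tendsto (fun n => nu n (k n) - (mu n (k n))^2) atTop atTop) := by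

  intro k _
  obtain ⟨C, hC, hup⟩ := VV_upper
  obtain ⟨c, hc, hlow⟩ := VV_lower
  constructor
  · intro h
    refine tendsto_atTop_mono' atTop ?_ (h.const_mul_atTop hc)
    filter_upwards [h.eventually_gt_atTop 8] with n hn
    have hk : 3 ≤ k n := by
      by_contra hlt
      have h1 : mu n (k n) ≤ 2^(k n) := by
        rw [mu_dd]
        have := mul_le_mul_of_nonneg_left (dd_le_one n (k n + 1)) (show (0:ℝ) ≤ 2^(k n) by positivity)
        linarith
      have h2 : (2:ℝ)^(k n) ≤ 2^3 := pow_le_pow_right₀ (by norm_num) (by omega)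
      norm_num at h2
      linarith
    obtain ⟨r, hr⟩ := Nat.exists_eq_add_of_le' hk
    have := hlow r n
    rw [hr]
    exact this
  · intro h
    refine tendsto_atTop_mono' atTop ?_ (h.const_mul_atTop (inv_pos.2 hC))
    filter_upwards with n
    have := hup n (k n)
    unfold VV at this
    rw [inv_mul_le_iff₀ hC]
    exact this
end
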